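/- arXiv:0803.1947 — 10 statements merged into one kernel-verified Lean document; each statement's English description precedes it below -/
import Mathlib

section
/- The property S₁(Ω,Γ) is linearly-σ-additive: if X₁ ⊆ X₂ ⊆ X₃ ⊆ ⋯ is an increasing sequence of subsets of a topological space such that each Xₙ, with the subspace topology, satisfies S₁(Ω,Γ), then the union ⋃ₙ Xₙ, with the subspace topology, satisfies S₁(Ω,Γ). -/
open Set

variable (X : Type*) [TopologicalSpace X]

/-- `𝒰` is an open cover of the space `X`: a family of open sets covering `X`. -/
def IsOpenCoverOf (𝒰 : Set (Set X)) : Prop :=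
  (∀ U ∈ 𝒰, IsOpen U) ∧ ∀ x : X, ∃ U ∈ 𝒰, x ∈ U

/-- `𝒰` is an ω-cover of `X`: an open cover not containing `X` itself,
such that every finite subset of `X` is contained in some member of `𝒰`. -/
def IsOmegaCoverOf (𝒰 : Set (Set X)) : Prop :=
  IsOpenCoverOf X 𝒰 ∧ Set.univ ∉ 𝒰 ∧ ∀ F : Set X, F.Finite → ∃ U ∈ 𝒰, F ⊆ U

/-- `𝒰` is a γ-cover of `X`: an infinite open cover such that every point of `X`
belongs to all but finitely many members of `𝒰`. -/
def IsGammaCoverOf (𝒰 : Set (Set X)) : Prop :=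
  IsOpenCoverOf X 𝒰 ∧ 𝒰.Infinite ∧ ∀ x : X, {U ∈ 𝒰 | x ∉ U}.Finite

/-- The selection principle `S₁(A, B)`: for every sequence of covers from class `A`,
one can pick one member from each so that the chosen sets form a cover from class `B`. -/
def S1 (A B : Set (Set X) → Prop) : Prop :=
  ∀ 𝒰 : ℕ → Set (Set X), (∀ n, A (𝒰 n)) →
    ∃ U : ℕ → Set X, (∀ n, U n ∈ 𝒰 n) ∧ B (Set.range U)

/-- The selection principle `Sfin(A, B)`: for every sequence of covers from class `A`,
one can pick finite subfamilies whose union is a cover from class `B`. -/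
def Sfin (A B : Set (Set X) → Prop) : Prop :=
  ∀ 𝒰 : ℕ → Set (Set X), (∀ n, A (𝒰 n)) →
    ∃ F : ℕ → Set (Set X), (∀ n, F n ⊆ 𝒰 n ∧ (F n).Finite) ∧ B (⋃ n, F n)

/-- The selection principle `Ufin(Γ, B)`: for every sequence of open covers of `X`,
none of which contains a finite subfamily covering `X`, one can pick finite
subfamilies `F n` such that the family of unions `⋃₀ F n` belongs to class `B`. -/
def Ufin (B : Set (Set X) → Prop) : Prop :=
  ∀ 𝒰 : ℕ → Set (Set X),
    (∀ n, IsOpenCoverOf X (𝒰 n) ∧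
      ¬ ∃ F ⊆ 𝒰 n, F.Finite ∧ ∀ x : X, ∃ U ∈ F, x ∈ U) →
    ∃ F : ℕ → Set (Set X), (∀ n, F n ⊆ 𝒰 n ∧ (F n).Finite) ∧
      B (Set.range fun n => ⋃₀ F n)

open Filter

/-- From every sequence of families of open sets, each capturing all finite subsets of `Y`, one can
select members that eventually contain each point of `Y`. Unlike in `S1`, members of the
families may contain all of `Y`, and the selection is a convergent sequence. -/
def HasOmegaSelections {α : Type*} [TopologicalSpace α] (Y : Set α) : Prop :=
  ∀ 𝒰 : ℕ → Set (Set α), (∀ n, ∀ U ∈ 𝒰 n, IsOpen U) →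
    (∀ n, ∀ F : Set α, F.Finite → F ⊆ Y → ∃ U ∈ 𝒰 n, F ⊆ U) →
    ∃ U : ℕ → Set α, (∀ n, U n ∈ 𝒰 n) ∧ ∀ y ∈ Y, ∀ᶠ n in atTop, y ∈ U n

/-- A sequence of sets whose range is a γ-cover has arbitrarily late terms that can be arranged
into a sequence eventually containing each point. -/
theorem IsGammaCoverOf.exists_eventually_mem {β : Type*} [TopologicalSpace β] {V : ℕ → Set β}
    (hV : IsGammaCoverOf β (Set.range V)) :
    ∃ φ : ℕ → ℕ, (∀ n, n ≤ φ n) ∧ ∀ y, ∀ᶠ n in atTop, y ∈ V (φ n) := by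
  obtain ⟨-, hinf, hfin⟩ := hV
  let g := hinf.natEmbedding
  choose ψ hψ using fun k => (g k).2
  have hinj : Function.Injective fun k => V (ψ k) := by
    intro a b hab
    apply g.injective
    apply Subtype.ext
    rw [← hψ a, ← hψ b]
    exact hab
  have hψinj : Function.Injective ψ := fun a b hab => hinj (congrArg V hab)
  have htend : Tendsto ψ atTop atTop := by
    simpa [Nat.cofinite_eq_atTop] using hψinj.tendsto_cofinite
  have hlate : ∀ n, ∃ k, n ≤ k ∧ n ≤ ψ k := fun n =>
    ((eventually_ge_atTop n).and (htend.eventually_ge_atTop n)).exists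
  choose κ hκ hψκ using hlate
  refine ⟨fun n => ψ (κ n), hψκ, fun y => ?_⟩
  have hy : ∀ᶠ k in atTop, y ∈ V (ψ k) := by
    rw [← Nat.cofinite_eq_atTop, eventually_cofinite]
    refine Set.Finite.subset ((hfin y).preimage hinj.injOn) fun k hk => ?_
    exact ⟨⟨ψ k, rfl⟩, hk⟩
  exact (tendsto_atTop_mono hκ tendsto_id).eventually hy

theorem S1.hasOmegaSelections {α : Type*} [TopologicalSpace α] {Y : Set α}
    (h : S1 Y (IsOmegaCoverOf Y) (IsGammaCoverOf Y)) : HasOmegaSelections Y := by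
  intro 𝒰 hopen hω
  by_cases hfull : ∀ n, ∃ U ∈ 𝒰 n, Y ⊆ U
  · choose U hU hYU using hfull
    exact ⟨U, hU, fun y hy => .of_forall fun n => hYU n hy⟩
  push Not at hfull
  obtain ⟨N, hN⟩ := hfull
  let 𝒲 : ℕ → Set (Set Y) := fun n =>
    {W | ∃ u : ℕ → Set α, (∀ i, u i ∈ 𝒰 i) ∧ W = (↑) ⁻¹' ⋂ i ∈ Finset.range (N + n + 1), u i}
  have hfinite : ∀ n, ∀ F : Set Y, F.Finite → ∃ W ∈ 𝒲 n, F ⊆ W := by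
    intro n F hF
    choose u hu hFu using fun i => hω i ((↑) '' F) (hF.image _) (by simp)
    refine ⟨_, ⟨u, hu, rfl⟩, fun y hy => ?_⟩
    simp only [Set.mem_preimage, Set.mem_iInter]
    exact fun i _ => hFu i ⟨y, hy, rfl⟩
  obtain ⟨V, hV, hγ⟩ := h 𝒲 fun n => by
    refine ⟨⟨?_, fun y => ?_⟩, ?_, hfinite n⟩
    · rintro _ ⟨u, hu, rfl⟩
      exact (isOpen_biInter_finset fun i _ => hopen i _ (hu i)).preimage continuous_subtype_val
    · obtain ⟨W, hW, hyW⟩ := hfinite n {y} (Set.finite_singleton y)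
      exact ⟨W, hW, hyW rfl⟩
    · rintro ⟨u, hu, huniv⟩
      refine hN (u N) (hu N) fun y hy => ?_
      have hmem : (⟨y, hy⟩ : Y) ∈ (Set.univ : Set Y) := trivial
      rw [huniv] at hmem
      simp only [Set.mem_preimage, Set.mem_iInter] at hmem
      exact hmem N (by simp)
  obtain ⟨φ, hφ, hmem⟩ := hγ.exists_eventually_mem
  choose u hu hVu using hV
  refine ⟨fun n => u (φ n) n, fun n => hu _ _, fun y hy => ?_⟩
  filter_upwards [hmem ⟨y, hy⟩] with n hn
  rw [hVu] at hn
  simp only [Set.mem_preimage, Set.mem_iInter] at hn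
  exact hn n (by have := hφ n; simp; omega)

/-- Sheaf amalgamation: countably many sequences of open sets converging on `Y` can be thinned out
to infinite subsequences so that each point of `Y` lies in all terms of almost all of them. -/
theorem HasOmegaSelections.exists_infinite_subset {α : Type*} [TopologicalSpace α] {Y : Set α}
    (h : HasOmegaSelections Y) {A : ℕ → ℕ → Set α} (hA : ∀ k i, IsOpen (A k i)) {m : ℕ}
    (hconv : ∀ k, m ≤ k → ∀ y ∈ Y, ∀ᶠ i in atTop, y ∈ A k i)
    {I : ℕ → Set ℕ} (hI : ∀ k, (I k).Infinite) :
    ∃ J : ℕ → Set ℕ, (∀ k, (J k).Infinite) ∧ (∀ k, J k ⊆ I k) ∧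
      ∀ y ∈ Y, ∀ᶠ k in atTop, ∀ i ∈ J k, y ∈ A k i := by
  let B : ℕ → ℕ → Set α := fun k i => if m ≤ k then A k i else Set.univ
  have hB : ∀ k i, IsOpen (B k i) := by
    intro k i
    dsimp only [B]
    split_ifs
    exacts [hA k i, isOpen_univ]
  have hBconv : ∀ k, ∀ y ∈ Y, ∀ᶠ i in atTop, y ∈ B k i := by
    intro k y hy
    by_cases hk : m ≤ k
    · simpa [B, hk] using hconv k hk y hy
    · simp [B, hk]
  obtain ⟨U, hU, hUY⟩ := h
    (fun n => {V | ∃ i ∈ I n.unpair.1, n.unpair.2 ≤ i ∧ V = B n.unpair.1 i})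
    (by rintro n _ ⟨i, -, -, rfl⟩; exact hB _ _) (by
      intro n F hF hFY
      have hev : ∀ᶠ i in atTop, ∀ y ∈ F, y ∈ B n.unpair.1 i :=
        (eventually_all_finite hF).2 fun y hy => hBconv _ y (hFY hy)
      have hfreq : ∃ᶠ i in atTop, i ∈ I n.unpair.1 :=
        Nat.frequently_atTop_iff_infinite.2 (hI n.unpair.1)
      obtain ⟨i, hi, hge, hFi⟩ :=
        (hfreq.and_eventually ((eventually_ge_atTop n.unpair.2).and hev)).exists
      exact ⟨_, ⟨i, hi, hge, rfl⟩, hFi⟩)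
  choose f hfI hfge hUf using hU
  refine ⟨fun k => Set.range fun j => f (Nat.pair k j), fun k => ?_, fun k => ?_, fun y hy => ?_⟩
  · refine Nat.frequently_atTop_iff_infinite.1 (frequently_atTop.2 fun j => ?_)
    exact ⟨_, by simpa using hfge (Nat.pair k j), j, rfl⟩
  · rintro _ ⟨j, rfl⟩
    simpa using hfI (Nat.pair k j)
  · obtain ⟨M, hM⟩ := eventually_atTop.1 (hUY y hy)
    filter_upwards [eventually_ge_atTop M, eventually_ge_atTop m] with k hkM hkm
    rintro _ ⟨j, rfl⟩
    have hmem := hM (Nat.pair k j) (hkM.trans (Nat.left_le_pair k j))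
    rw [hUf] at hmem
    simpa [B, hkm] using hmem

theorem HasOmegaSelections.iUnion {α : Type*} [TopologicalSpace α] {Y : ℕ → Set α}
    (hmono : Monotone Y) (h : ∀ n, HasOmegaSelections (Y n)) :
    HasOmegaSelections (⋃ n, Y n) := by
  intro 𝒰 hopen hω
  choose A hA𝒰 hAY using fun n => h n (fun _ => 𝒰 n) (fun _ => hopen n)
    fun _ F hF hFY => hω n F hF (hFY.trans (Set.subset_iUnion Y n))
  have step : ∀ (m : ℕ) (I : {I : ℕ → Set ℕ // ∀ k, (I k).Infinite}),
      ∃ J : {J : ℕ → Set ℕ // ∀ k, (J k).Infinite}, (∀ k, J.1 k ⊆ I.1 k) ∧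
        ∀ y ∈ Y m, ∀ᶠ k in atTop, ∀ i ∈ J.1 k, y ∈ A k i := by
    intro m I
    obtain ⟨J, hJ, hJI, hJY⟩ := (h m).exists_infinite_subset
      (fun k i => hopen k _ (hA𝒰 k i)) (fun k hk y hy => hAY k y (hmono hk hy)) I.2
    exact ⟨⟨J, hJ⟩, hJI, hJY⟩
  choose next hsub hnext using step
  let I : ℕ → {I : ℕ → Set ℕ // ∀ k, (I k).Infinite} := fun n =>
    Nat.rec ⟨fun _ => Set.univ, fun _ => Set.infinite_univ⟩ next n
  have hanti : ∀ k, Antitone fun n => (I n).1 k := fun k =>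
    antitone_nat_of_succ_le fun n => hsub n (I n) k
  choose c hc using fun k => ((I (k + 1)).2 k).nonempty
  refine ⟨fun k => A k (c k), fun k => hA𝒰 k _, fun y hy => ?_⟩
  obtain ⟨m, hm⟩ := Set.mem_iUnion.1 hy
  filter_upwards [hnext m (I m) y hm, eventually_ge_atTop m] with k hk hmk
  exact hk _ (hanti k (Nat.succ_le_succ hmk) (hc k))

theorem HasOmegaSelections.s1 {α : Type*} [TopologicalSpace α] {Y : Set α}
    (h : HasOmegaSelections Y) : S1 Y (IsOmegaCoverOf Y) (IsGammaCoverOf Y) := by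
  intro 𝒰 h𝒰
  obtain ⟨U, hU, hUY⟩ := h (fun n => {O | IsOpen O ∧ (↑) ⁻¹' O ∈ 𝒰 n}) (fun n O hO => hO.1) (by
    intro n F hF hFY
    obtain ⟨V, hV, hFV⟩ := (h𝒰 n).2.2 ((↑) ⁻¹' F) (hF.preimage Subtype.val_injective.injOn)
    obtain ⟨O, hO, rfl⟩ := isOpen_induced_iff.1 ((h𝒰 n).1.1 V hV)
    exact ⟨O, ⟨hO, hV⟩, fun y hy => hFV (show (⟨y, hFY hy⟩ : Y) ∈ _ from hy)⟩)
  let V : ℕ → Set Y := fun n => (↑) ⁻¹' U n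
  have hV : ∀ y, ∀ᶠ n in atTop, y ∈ V n := fun y => hUY y y.2
  refine ⟨V, fun n => (hU n).2, ⟨?_, fun y => ?_⟩, fun hfin => ?_, fun y => ?_⟩
  · rintro _ ⟨n, rfl⟩
    exact (h𝒰 n).1.1 _ (hU n).2
  · obtain ⟨n, hn⟩ := (hV y).exists
    exact ⟨_, ⟨n, rfl⟩, hn⟩
  · have := hfin.to_subtype
    obtain ⟨⟨W, hW⟩, hinf⟩ := Finite.exists_infinite_fiber (Set.rangeFactorization V)
    have hfreq : ∃ᶠ n in atTop, V n = W := by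
      refine Nat.frequently_atTop_iff_infinite.2 ?_
      refine (Set.infinite_coe_iff.1 hinf).mono fun n hn => ?_
      exact congrArg Subtype.val hn
    have huniv : W = Set.univ := Set.eq_univ_of_forall fun y => by
      obtain ⟨n, rfl, hn⟩ := (hfreq.and_eventually (hV y)).exists
      exact hn
    obtain ⟨n, hn⟩ := hfreq.exists
    exact (h𝒰 n).2.1 (huniv ▸ hn ▸ (hU n).2)
  · have hy : {n | y ∉ V n}.Finite := by
      simpa [← Nat.cofinite_eq_atTop, eventually_cofinite] using hV y
    refine (hy.image V).subset ?_
    rintro _ ⟨⟨n, rfl⟩, hn⟩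
    exact ⟨n, hn, rfl⟩

theorem s1_omega_gamma_linearly_sigma_additive {α : Type*} [TopologicalSpace α] (X : ℕ → Set α)
    (hmono : ∀ n, X n ⊆ X (n + 1))
    (h : ∀ n, S1 (X n) (IsOmegaCoverOf (X n)) (IsGammaCoverOf (X n))) :
    S1 (⋃ n, X n) (IsOmegaCoverOf (⋃ n, X n)) (IsGammaCoverOf (⋃ n, X n)) :=
  (HasOmegaSelections.iUnion (monotone_nat_of_le_succ hmono)
    fun n => S1.hasOmegaSelections (h n)).s1
end

section
/- The property S₁(Γ,Ω) is linearly-σ-additive: if X₁ ⊆ X₂ ⊆ X₃ ⊆ ⋯ is an increasing sequence of subsets of a topological space such that each Xₙ, with the subspace topology, satisfies S₁(Γ,Ω), then the union ⋃ₙ Xₙ, with the subspace topology, satisfies S₁(Γ,Ω). -/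
open Set

variable (X : Type*) [TopologicalSpace X]

/-- Every point lies in a member of an infinite family that omits it only finitely often. -/
theorem IsGammaCoverOf.of_infinite {Y : Type*} [TopologicalSpace Y] {𝒰 : Set (Set Y)}
    (hopen : ∀ U ∈ 𝒰, IsOpen U) (hinf : 𝒰.Infinite)
    (hfin : ∀ y : Y, {U ∈ 𝒰 | y ∉ U}.Finite) : IsGammaCoverOf Y 𝒰 := by
  refine ⟨⟨hopen, fun y => ?_⟩, hinf, hfin⟩
  by_contra! hy
  exact hinf ((hfin y).subset fun U hU => ⟨hU, hy U hU⟩)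

/-- Infinite subfamilies of γ-covers are γ-covers. -/
theorem IsGammaCoverOf.mono {Y : Type*} [TopologicalSpace Y] {𝒰 𝒱 : Set (Set Y)}
    (h𝒰 : IsGammaCoverOf Y 𝒰) (hsub : 𝒱 ⊆ 𝒰) (hinf : 𝒱.Infinite) : IsGammaCoverOf Y 𝒱 :=
  .of_infinite (fun U hU => h𝒰.1.1 U (hsub hU)) hinf
    fun y => (h𝒰.2.2 y).subset fun _ hU => ⟨hsub hU.1, hU.2⟩

/-- The preimages of a γ-cover form a γ-cover, provided no member contains the range. -/
theorem IsGammaCoverOf.image_preimage {Y Z : Type*} [TopologicalSpace Y] [TopologicalSpace Z]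
    {f : Y → Z} (hf : Continuous f) {𝒰 : Set (Set Z)} (h𝒰 : IsGammaCoverOf Z 𝒰)
    (hrange : ∀ U ∈ 𝒰, ∃ y, f y ∉ U) : IsGammaCoverOf Y ((f ⁻¹' ·) '' 𝒰) := by
  refine .of_infinite ?_ ?_ ?_
  · rintro _ ⟨U, hU, rfl⟩
    exact (h𝒰.1.1 U hU).preimage hf
  · refine fun hfin => h𝒰.2.1 (hfin.of_finite_fibers _ ?_)
    rintro _ ⟨U, hU, rfl⟩
    obtain ⟨y, hy⟩ := hrange U hU
    refine (h𝒰.2.2 (f y)).subset fun V hV => ⟨hV.1, fun hyV => hy ?_⟩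
    have hVU : f ⁻¹' V = f ⁻¹' U := hV.2
    exact hVU.subset hyV
  · intro y
    refine ((h𝒰.2.2 (f y)).image (f ⁻¹' ·)).subset ?_
    rintro _ ⟨⟨U, hU, rfl⟩, hy⟩
    exact ⟨U, ⟨hU, hy⟩, rfl⟩

/-- If `Y` satisfies `S₁(Γ, Ω)` and maps continuously to `Z`, then from a sequence of γ-covers
of `Z` one can select sets capturing the image of every finite subset of `Y`. -/
theorem S1.exists_selection_of_continuous {Y Z : Type*} [TopologicalSpace Y] [TopologicalSpace Z]
    (hY : S1 Y (IsGammaCoverOf Y) (IsOmegaCoverOf Y)) {f : Y → Z} (hf : Continuous f)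
    {𝒰 : ℕ → Set (Set Z)} (h𝒰 : ∀ n, IsGammaCoverOf Z (𝒰 n)) :
    ∃ U : ℕ → Set Z, (∀ n, U n ∈ 𝒰 n) ∧ ∀ F : Set Y, F.Finite → ∃ n, F ⊆ f ⁻¹' U n := by
  by_cases hrange : ∃ n, ∃ U ∈ 𝒰 n, ∀ y, f y ∈ U
  · obtain ⟨n, V, hV, hfV⟩ := hrange
    choose W hW using fun m => (h𝒰 m).2.1.nonempty
    refine ⟨Function.update W n V, fun m => ?_, fun F _ => ⟨n, fun y _ => ?_⟩⟩
    · rcases eq_or_ne m n with rfl | hm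
      · simpa using hV
      · simpa [hm] using hW m
    · simpa using hfV y
  · push Not at hrange
    obtain ⟨V, hV, hΩ⟩ := hY _ fun n => (h𝒰 n).image_preimage hf (hrange n)
    choose U hU hUV using hV
    refine ⟨U, hU, fun F hF => ?_⟩
    obtain ⟨_, ⟨n, rfl⟩, hn⟩ := hΩ.2.2 F hF
    exact ⟨n, hn.trans (hUV n).superset⟩

theorem s1_gamma_omega_linearly_sigma_additive {α : Type*} [TopologicalSpace α] (X : ℕ → Set α)
    (hmono : ∀ n, X n ⊆ X (n + 1))
    (h : ∀ n, S1 (X n) (IsGammaCoverOf (X n)) (IsOmegaCoverOf (X n))) :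
    S1 (⋃ n, X n) (IsGammaCoverOf (⋃ n, X n)) (IsOmegaCoverOf (⋃ n, X n)) := by
  intro 𝒰 h𝒰
  have h𝒱 (k : ℕ) : IsGammaCoverOf (⋃ n, X n) (𝒰 k \ {univ}) :=
    (h𝒰 k).mono sdiff_subset ((h𝒰 k).2.1.sdiff (finite_singleton _))
  choose V hV hVF using fun n => (h n).exists_selection_of_continuous
    (continuous_inclusion (subset_iUnion X n)) fun m => h𝒱 (Nat.pair n m)
  let U (k : ℕ) : Set (⋃ n, X n) := V k.unpair.1 k.unpair.2
  have hU (k : ℕ) : U k ∈ 𝒰 k \ {univ} := by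
    simpa only [Nat.pair_unpair] using hV k.unpair.1 k.unpair.2
  have hω (F : Set (⋃ n, X n)) (hF : F.Finite) : ∃ W ∈ range U, F ⊆ W := by
    obtain ⟨s, hs⟩ := (hF.image Subtype.val).exists_finset_coe
    obtain ⟨n, hn⟩ :=
      (monotone_nat_of_le_succ hmono).directed_le.exists_mem_subset_of_finset_subset_biUnion
        (hs.trans_subset (Subtype.coe_image_subset _ F))
    rw [hs] at hn
    obtain ⟨m, hm⟩ := hVF n (inclusion (subset_iUnion X n) ⁻¹' F)
      (hF.preimage (inclusion_injective _).injOn)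
    refine ⟨U (Nat.pair n m), mem_range_self _, fun x hx => ?_⟩
    have hxV : x ∈ V n m := @hm ⟨x, hn (mem_image_of_mem _ hx)⟩ hx
    simpa only [U, Nat.unpair_pair] using hxV
  refine ⟨U, fun k => (hU k).1, ⟨?_, fun x => ?_⟩, ?_, hω⟩
  · rintro _ ⟨k, rfl⟩
    exact (h𝒱 k).1.1 _ (hU k)
  · obtain ⟨W, hW, hxW⟩ := hω {x} (finite_singleton x)
    exact ⟨W, hW, hxW rfl⟩
  · rintro ⟨k, hk⟩
    exact (hU k).2 hk
end

section
/- The property S₁(Γ,Ω) is hereditary for Fσ subsets: if a topological space X satisfies S₁(Γ,Ω) and F ⊆ X is a countable union of closed subsets of X, then F, with the subspace topology, satisfies S₁(Γ,Ω). -/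
open Set

variable (X : Type*) [TopologicalSpace X]

/-- The subset of `α` agreeing with `U : Set S` on `D` and containing the complement of `D`. -/
def extendOutside {α : Type*} (S D : Set α) (hDS : D ⊆ S) (U : Set S) : Set α :=
  {x | ∀ hx : x ∈ D, (⟨x, hDS hx⟩ : S) ∈ U}

theorem isOpen_extendOutside {α : Type*} [TopologicalSpace α] {S D : Set α} (hDS : D ⊆ S)
    (hD : IsClosed D) {U : Set S} (hU : IsOpen U) : IsOpen (extendOutside S D hDS U) := by
  obtain ⟨O, hO, rfl⟩ := isOpen_induced_iff.1 hU
  have : extendOutside S D hDS (Subtype.val ⁻¹' O) = Dᶜ ∪ O := by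
    ext x
    simp only [extendOutside, mem_ofPred_eq, mem_preimage, mem_union, mem_compl_iff]
    tauto
  exact this ▸ hD.isOpen_compl.union hO

theorem IsGammaCoverOf.exists_ne_univ {Y : Type*} [TopologicalSpace Y] {𝒰 : Set (Set Y)}
    (h𝒰 : IsGammaCoverOf Y 𝒰) : ∃ U ∈ 𝒰, U ≠ univ := by
  obtain ⟨U, hU, hne⟩ := h𝒰.2.1.exists_notMem_finite (finite_singleton univ)
  exact ⟨U, hU, hne⟩

/-- If no proper member of a γ-cover of `S` contains the closed set `D ⊆ S`, then the extensions
of its proper members form a γ-cover of the ambient space. -/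
theorem IsGammaCoverOf.image_extendOutside {α : Type*} [TopologicalSpace α] {S D : Set α}
    (hDS : D ⊆ S) (hD : IsClosed D) {𝒰 : Set (Set S)} (h𝒰 : IsGammaCoverOf S 𝒰)
    (hproper : ∀ U ∈ 𝒰, U ≠ univ → extendOutside S D hDS U ≠ univ) :
    IsGammaCoverOf α (extendOutside S D hDS '' (𝒰 \ {univ})) := by
  have hmiss : ∀ x : α, {U ∈ 𝒰 | x ∉ extendOutside S D hDS U}.Finite := by
    intro x
    by_cases hx : x ∈ D
    · refine (h𝒰.2.2 ⟨x, hDS hx⟩).subset fun U hU => ⟨hU.1, fun hxU => hU.2 fun _ => hxU⟩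
    · refine finite_empty.subset fun U hU => hU.2 fun hx' => absurd hx' hx
  have hinf : (extendOutside S D hDS '' (𝒰 \ {univ})).Infinite := by
    intro hfin
    refine h𝒰.2.1.sdiff (finite_singleton univ) (Finite.of_finite_fibers _ hfin ?_)
    rintro _ ⟨U, hU, rfl⟩
    obtain ⟨x, hx⟩ := (ne_univ_iff_exists_notMem _).1 (hproper U hU.1 hU.2)
    refine (hmiss x).subset fun V hV => ⟨hV.1.1, ?_⟩
    rwa [show extendOutside S D hDS V = _ from hV.2]
  have hcofin : ∀ x : α, {V ∈ extendOutside S D hDS '' (𝒰 \ {univ}) | x ∉ V}.Finite := by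
    intro x
    refine ((hmiss x).image (extendOutside S D hDS)).subset ?_
    rintro _ ⟨⟨U, hU, rfl⟩, hx⟩
    exact ⟨U, ⟨hU.1, hx⟩, rfl⟩
  refine ⟨⟨?_, fun x => ?_⟩, hinf, hcofin⟩
  · rintro _ ⟨U, hU, rfl⟩
    exact isOpen_extendOutside hDS hD (h𝒰.1.1 U hU.1)
  · obtain ⟨V, hV, hxV⟩ := hinf.exists_notMem_finite (hcofin x)
    exact ⟨V, hV, by_contra fun hx => hxV ⟨hV, hx⟩⟩

/-- If `α` satisfies `S₁(Γ, Ω)` and `D ⊆ S` is closed in `α`, then from any sequence of γ-covers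
of `S` one can choose proper subsets of `S` containing all finite subsets of `D`. -/
theorem S1.exists_selection_of_isClosed_subset {α : Type*} [TopologicalSpace α]
    (h : S1 α (IsGammaCoverOf α) (IsOmegaCoverOf α)) {S D : Set α} (hDS : D ⊆ S)
    (hD : IsClosed D) (𝒰 : ℕ → Set (Set S)) (h𝒰 : ∀ n, IsGammaCoverOf S (𝒰 n)) :
    ∃ U : ℕ → Set S, (∀ n, U n ∈ 𝒰 n ∧ U n ≠ univ) ∧
      ∀ F : Set S, F.Finite → (∀ x ∈ F, (x : α) ∈ D) → ∃ n, F ⊆ U n := by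
  by_cases hproper : ∀ n, ∀ U ∈ 𝒰 n, U ≠ univ → extendOutside S D hDS U ≠ univ
  · obtain ⟨V, hV, hω⟩ := h _ fun n => (h𝒰 n).image_extendOutside hDS hD (hproper n)
    choose U hU hUV using hV
    refine ⟨U, hU, fun F hF hFD => ?_⟩
    obtain ⟨_, ⟨n, rfl⟩, hn⟩ := hω.2.2 (Subtype.val '' F) (hF.image _)
    refine ⟨n, fun x hx => ?_⟩
    have hxV := hn (mem_image_of_mem _ hx)
    rw [← hUV n] at hxV
    exact hxV (hFD x hx)
  · push Not at hproper
    obtain ⟨n, U, hU, hne, huniv⟩ := hproper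
    choose V hV using fun m => (h𝒰 m).exists_ne_univ
    refine ⟨Function.update V n U, fun m => ?_, fun F _ hFD => ⟨n, fun x hx => ?_⟩⟩
    · rcases eq_or_ne m n with rfl | hm
      · simpa using ⟨hU, hne⟩
      · simpa [hm] using hV m
    · have hx' : (x : α) ∈ extendOutside S D hDS U := huniv ▸ mem_univ _
      simpa using hx' (hFD x hx)

theorem s1_gamma_omega_hereditary_Fsigma {α : Type*} [TopologicalSpace α]
    (h : S1 (α) (IsGammaCoverOf (α)) (IsOmegaCoverOf (α)))
    (C : ℕ → Set α) (hC : ∀ n, IsClosed (C n)) :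
    S1 (⋃ n, C n) (IsGammaCoverOf (⋃ n, C n)) (IsOmegaCoverOf (⋃ n, C n)) := by
  intro 𝒰 h𝒰
  have hsub : ∀ k, accumulate C k ⊆ ⋃ n, C n := fun k =>
    iUnion₂_subset fun i _ => subset_iUnion C i
  have hclosed : ∀ k, IsClosed (accumulate C k) := fun k =>
    (finite_Iic k).isClosed_biUnion fun i _ => hC i
  choose U hU hUF using fun k => h.exists_selection_of_isClosed_subset (hsub k) (hclosed k)
    (fun m => 𝒰 (Nat.pair k m)) (fun m => h𝒰 _)
  have hmem : ∀ n, U n.unpair.1 n.unpair.2 ∈ 𝒰 n ∧ U n.unpair.1 n.unpair.2 ≠ univ := fun n => by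
    simpa using hU n.unpair.1 n.unpair.2
  have hfinite : ∀ F : Set (⋃ n, C n), F.Finite →
      ∃ V ∈ range fun n : ℕ => U n.unpair.1 n.unpair.2, F ⊆ V := by
    intro F hF
    choose i hi using fun x : (⋃ n, C n) => mem_iUnion.1 x.2
    obtain ⟨k, hk⟩ := (hF.image i).bddAbove
    obtain ⟨m, hm⟩ := hUF k F hF fun x hx =>
      mem_accumulate.2 ⟨i x, hk (mem_image_of_mem i hx), hi x⟩
    exact ⟨_, ⟨Nat.pair k m, rfl⟩, by simpa using hm⟩
  refine ⟨fun n => U n.unpair.1 n.unpair.2, fun n => (hmem n).1, ⟨?_, fun x => ?_⟩, ?_, hfinite⟩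
  · rintro _ ⟨n, rfl⟩
    exact (h𝒰 n).1.1 _ (hmem n).1
  · obtain ⟨V, hV, hxV⟩ := hfinite {x} (finite_singleton x)
    exact ⟨V, hV, hxV rfl⟩
  · rintro ⟨n, hn⟩
    exact (hmem n).2 hn
end

section
/- The property Sfin(Γ,Ω) is hereditary for Fσ subsets: if a topological space X satisfies Sfin(Γ,Ω) and F ⊆ X is a countable union of closed subsets of X, then F, with the subspace topology, satisfies Sfin(Γ,Ω). -/
open Set

variable (X : Type*) [TopologicalSpace X]

/-- Complement in `α` of the part of `C` missed by the subset `U` of the subspace `S`. -/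
def relExtension {α : Type*} {S : Set α} (C : Set α) (U : Set S) : Set α :=
  (Subtype.val '' Uᶜ ∩ C)ᶜ

theorem mem_relExtension {α : Type*} {S C : Set α} {U : Set S} (x : S) (hx : (x : α) ∈ C) :
    (x : α) ∈ relExtension C U ↔ x ∈ U := by
  simp [relExtension, hx]

theorem mem_relExtension_of_notMem {α : Type*} {S C : Set α} {U : Set S} {x : α} (hx : x ∉ C) :
    x ∈ relExtension C U := by
  simp [relExtension, hx]

theorem isOpen_relExtension {α : Type*} [TopologicalSpace α] {S C : Set α} (hC : IsClosed C)
    (hCS : C ⊆ S) {U : Set S} (hU : IsOpen U) : IsOpen (relExtension C U) := by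
  obtain ⟨K, hK, hKU⟩ := isClosed_induced_iff.1 hU.isClosed_compl
  have : Subtype.val '' Uᶜ ∩ C = K ∩ C := by
    rw [← hKU, Subtype.image_preimage_coe, inter_assoc, inter_comm, inter_assoc,
      inter_eq_left.2 hCS]
  rw [relExtension, this]
  exact (hK.inter hC).isOpen_compl

/-- Extending the members of a γ-cover of a subspace by the complement of a closed set `C`
gives a γ-cover of the whole space, provided no member contains `C`. -/
theorem IsGammaCoverOf.image_relExtension {α : Type*} [TopologicalSpace α] {S C : Set α}
    (hC : IsClosed C) (hCS : C ⊆ S) {𝒰 : Set (Set S)} (h𝒰 : IsGammaCoverOf S 𝒰)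
    (hne : ∀ U ∈ 𝒰, ∃ x : S, (x : α) ∈ C ∧ x ∉ U) :
    IsGammaCoverOf α (relExtension C '' 𝒰) := by
  obtain ⟨⟨hopen, -⟩, hinf, hfin⟩ := h𝒰
  have himg : (relExtension C '' 𝒰).Infinite := by
    intro hf
    refine hinf (Finite.of_finite_fibers (relExtension C) hf fun V hV => ?_)
    obtain ⟨U, hU, rfl⟩ := hV
    obtain ⟨x, hxC, hxU⟩ := hne U hU
    refine (hfin x).subset fun W hW => ⟨hW.1, fun hxW => hxU ?_⟩
    have hWU : relExtension C W = relExtension C U := hW.2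
    rwa [← mem_relExtension x hxC, ← hWU, mem_relExtension x hxC]
  have hpt : ∀ x : α, {V ∈ relExtension C '' 𝒰 | x ∉ V}.Finite := by
    intro x
    by_cases hx : x ∈ C
    · refine ((hfin ⟨x, hCS hx⟩).image (relExtension C)).subset ?_
      rintro _ ⟨⟨U, hU, rfl⟩, hxU⟩
      exact ⟨U, ⟨hU, fun h => hxU ((mem_relExtension ⟨x, hCS hx⟩ hx).2 h)⟩, rfl⟩
    · refine finite_empty.subset ?_
      rintro _ ⟨⟨U, hU, rfl⟩, hxU⟩
      exact hxU (mem_relExtension_of_notMem hx)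
  refine ⟨⟨?_, fun x => ?_⟩, himg, hpt⟩
  · rintro _ ⟨U, hU, rfl⟩
    exact isOpen_relExtension hC hCS (hopen U hU)
  · obtain ⟨V, hV, hxV⟩ := himg.exists_notMem_finite (hpt x)
    exact ⟨V, hV, by_contra fun h => hxV ⟨hV, h⟩⟩

/-- In a space satisfying `Sfin(Γ, Ω)`, from γ-covers of a subspace one can select finite
subfamilies capturing all finite subsets of a given closed set. -/
theorem Sfin.exists_finite_selection {α : Type*} [TopologicalSpace α]
    (h : Sfin α (IsGammaCoverOf α) (IsOmegaCoverOf α)) {S C : Set α}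
    (hC : IsClosed C) (hCS : C ⊆ S) (𝒰 : ℕ → Set (Set S))
    (h𝒰 : ∀ n, IsGammaCoverOf S (𝒰 n)) :
    ∃ F : ℕ → Set (Set S), (∀ n, F n ⊆ 𝒰 n ∧ (F n).Finite) ∧
      ∀ A : Set S, A.Finite → (∀ x ∈ A, (x : α) ∈ C) → ∃ U ∈ ⋃ n, F n, A ⊆ U := by
  by_cases hex : ∃ n, ∃ U ∈ 𝒰 n, ∀ x : S, (x : α) ∈ C → x ∈ U
  · obtain ⟨n, U, hU, hCU⟩ := hex
    refine ⟨fun k => {V | V = U ∧ k = n}, fun k => ⟨?_, ?_⟩, fun A _ hA => ⟨U, ?_, ?_⟩⟩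
    · rintro V ⟨rfl, rfl⟩
      exact hU
    · exact (finite_singleton U).subset fun V hV => hV.1
    · exact mem_iUnion.2 ⟨n, rfl, rfl⟩
    · exact fun x hx => hCU x (hA x hx)
  · push Not at hex
    obtain ⟨G, hG, -, -, hGω⟩ := h (fun n => relExtension C '' 𝒰 n) fun n =>
      (h𝒰 n).image_relExtension hC hCS (hex n)
    have hlift : ∀ n, ∃ F ⊆ 𝒰 n, F.Finite ∧ relExtension C '' F = G n := fun n =>
      exists_subset_image_finite_and (p := (· = G n)) |>.1 ⟨G n, (hG n).1, (hG n).2, rfl⟩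
    choose F hF𝒰 hFfin hFG using hlift
    refine ⟨F, fun n => ⟨hF𝒰 n, hFfin n⟩, fun A hA hAC => ?_⟩
    obtain ⟨V, hV, hAV⟩ := hGω (Subtype.val '' A) (hA.image _)
    obtain ⟨n, hn⟩ := mem_iUnion.1 hV
    rw [← hFG n] at hn
    obtain ⟨U, hU, rfl⟩ := hn
    exact ⟨U, mem_iUnion.2 ⟨n, hU⟩, fun x hx =>
      (mem_relExtension x (hAC x hx)).1 (hAV (mem_image_of_mem _ hx))⟩

theorem IsGammaCoverOf.diff_univ {X : Type*} [TopologicalSpace X] {𝒰 : Set (Set X)}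
    (h𝒰 : IsGammaCoverOf X 𝒰) : IsGammaCoverOf X (𝒰 \ {univ}) := by
  obtain ⟨⟨hopen, -⟩, hinf, hfin⟩ := h𝒰
  have hinf' : (𝒰 \ {univ}).Infinite := hinf.sdiff (finite_singleton _)
  refine ⟨⟨fun U hU => hopen U hU.1, fun x => ?_⟩, hinf',
    fun x => (hfin x).subset fun U hU => ⟨hU.1.1, hU.2⟩⟩
  obtain ⟨V, hV, hxV⟩ := hinf'.exists_notMem_finite (hfin x)
  exact ⟨V, hV, by_contra fun h => hxV ⟨hV.1, h⟩⟩

theorem sfin_gamma_omega_hereditary_Fsigma {α : Type*} [TopologicalSpace α]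
    (h : Sfin (α) (IsGammaCoverOf (α)) (IsOmegaCoverOf (α)))
    (C : ℕ → Set α) (hC : ∀ n, IsClosed (C n)) :
    Sfin (⋃ n, C n) (IsGammaCoverOf (⋃ n, C n)) (IsOmegaCoverOf (⋃ n, C n)) := by
  intro 𝒰 h𝒰
  have hD : ∀ m, IsClosed (accumulate C m) := fun m =>
    (finite_Iic m).isClosed_biUnion fun i _ => hC i
  choose F hF hFA using fun m => h.exists_finite_selection (hD m) (accumulate_subset_iUnion m)
    (fun k => 𝒰 (Nat.pair m k) \ {univ}) fun k => (h𝒰 (Nat.pair m k)).diff_univ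
  have hsub : ∀ n, F n.unpair.1 n.unpair.2 ⊆ 𝒰 n \ {univ} := fun n => by
    simpa using (hF n.unpair.1 n.unpair.2).1
  have hω : ∀ A : Set (⋃ n, C n), A.Finite →
      ∃ U ∈ ⋃ n : ℕ, F n.unpair.1 n.unpair.2, A ⊆ U := by
    intro A hA
    have hidx : ∀ x : (⋃ n, C n), ∃ i, (x : α) ∈ C i := fun x => mem_iUnion.1 x.2
    choose i hi using hidx
    obtain ⟨m, hm⟩ := (hA.image i).bddAbove
    obtain ⟨U, hU, hAU⟩ := hFA m A hA fun x hx =>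
      mem_accumulate.2 ⟨i x, hm (mem_image_of_mem i hx), hi x⟩
    obtain ⟨k, hk⟩ := mem_iUnion.1 hU
    exact ⟨U, mem_iUnion.2 ⟨Nat.pair m k, by simpa using hk⟩, hAU⟩
  refine ⟨fun n => F n.unpair.1 n.unpair.2, fun n => ⟨(hsub n).trans sdiff_subset, (hF _ _).2⟩,
    ⟨fun U hU => ?_, fun x => ?_⟩, fun hU => ?_, hω⟩
  · obtain ⟨n, hn⟩ := mem_iUnion.1 hU
    exact (h𝒰 n).1.1 U (hsub n hn).1
  · obtain ⟨U, hU, hxU⟩ := hω {x} (finite_singleton x)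
    exact ⟨U, hU, hxU rfl⟩
  · obtain ⟨n, hn⟩ := mem_iUnion.1 hU
    exact (hsub n hn).2 rfl
end

section
/- The property S₁(Γ,Γ) is linearly-σ-additive: if X₁ ⊆ X₂ ⊆ X₃ ⊆ ⋯ is an increasing sequence of subsets of a topological space such that each Xₙ, with the subspace topology, satisfies S₁(Γ,Γ), then the union ⋃ₙ Xₙ, with the subspace topology, satisfies S₁(Γ,Γ). -/
open Set

variable (X : Type*) [TopologicalSpace X]

/-- A sequence with infinite range has an injective subsequence. -/
theorem exists_strictMono_injective_comp {β : Type*} {g : ℕ → β} (hg : (range g).Infinite) :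
    ∃ φ : ℕ → ℕ, StrictMono φ ∧ Function.Injective (g ∘ φ) := by
  classical
  set A : Set ℕ := {n | ∀ i < n, g i ≠ g n}
  have hinf : A.Infinite := by
    intro hfin
    refine hg ((hfin.image g).subset ?_)
    rintro _ ⟨n, rfl⟩
    have hex : ∃ m, g m = g n := ⟨n, rfl⟩
    refine ⟨Nat.find hex, fun i hi hne => ?_, Nat.find_spec hex⟩
    exact Nat.find_min hex hi (hne.trans (Nat.find_spec hex))
  have hmem : ∀ n, Nat.nth (· ∈ A) n ∈ A := fun n => Nat.nth_mem_of_infinite hinf n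
  have hmono : StrictMono (Nat.nth (· ∈ A)) := Nat.nth_strictMono hinf
  refine ⟨_, hmono, fun a b hab => ?_⟩
  rcases lt_trichotomy a b with hlt | heq | hlt
  · exact absurd hab (hmem b _ (hmono hlt))
  · exact heq
  · exact absurd hab.symm (hmem a _ (hmono hlt))

/-- A sequence of infinite sets has an injective selector. -/
theorem exists_injective_forall_mem_of_infinite {β : Type*} {S : ℕ → Set β}
    (hS : ∀ n, (S n).Infinite) : ∃ W : ℕ → β, Function.Injective W ∧ ∀ n, W n ∈ S n := by
  classical
  choose t ht hcard using fun n => (hS n).exists_subset_card_eq (n + 1)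
  obtain ⟨W, hW, hWt⟩ := (Finset.all_card_le_biUnion_card_iff_exists_injective t).1 fun s => by
    rcases s.eq_empty_or_nonempty with rfl | hs
    · simp
    · have hsub : s ⊆ Finset.range (s.max' hs + 1) := fun i hi =>
        Finset.mem_range.2 (Nat.lt_succ_of_le (s.le_max' i hi))
      calc s.card ≤ s.max' hs + 1 := by simpa using Finset.card_le_card hsub
        _ = (t (s.max' hs)).card := (hcard _).symm
        _ ≤ (s.biUnion t).card :=
          Finset.card_le_card (Finset.subset_biUnion_of_mem t (s.max'_mem hs))
  exact ⟨W, hW, fun n => ht n (hWt n)⟩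

open Filter in
/-- A sequence of proper open sets, almost all of which contain any given point, enumerates
a γ-cover. -/
theorem isGammaCoverOf_range {Y : Type*} [TopologicalSpace Y] {v : ℕ → Set Y}
    (hopen : ∀ m, IsOpen (v m)) (hv : ∀ x, ∀ᶠ m in cofinite, x ∈ v m)
    (hne : ∀ m, v m ≠ univ) : IsGammaCoverOf Y (range v) := by
  refine ⟨⟨?_, fun x => ?_⟩, fun hfin => ?_, fun x => ?_⟩
  · rintro _ ⟨m, rfl⟩
    exact hopen m
  · obtain ⟨m, hm⟩ := (hv x).exists
    exact ⟨_, ⟨m, rfl⟩, hm⟩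
  · have : Finite (range v) := hfin
    obtain ⟨⟨_, m, rfl⟩, hT⟩ := Finite.exists_infinite_fiber (rangeFactorization v)
    obtain ⟨x, hx⟩ := (ne_univ_iff_exists_notMem _).1 (hne m)
    refine (infinite_coe_iff.1 hT) ((hv x).subset fun i hi => ?_)
    have hi' : v i = v m := congrArg Subtype.val hi
    simpa [hi'] using hx
  · refine (((hv x : {m | x ∈ v m}ᶜ.Finite)).image v).subset ?_
    rintro _ ⟨⟨m, rfl⟩, hm⟩
    exact ⟨m, hm, rfl⟩

open Filter in
/-- Sequential form of `S₁(Γ, Γ)`, in which repetitions and the whole space are allowed. -/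
theorem S1.exists_selector {Y : Type*} [TopologicalSpace Y]
    (h : S1 Y (IsGammaCoverOf Y) (IsGammaCoverOf Y)) {u : ℕ → ℕ → Set Y}
    (hopen : ∀ n m, IsOpen (u n m)) (hu : ∀ n x, ∀ᶠ m in cofinite, x ∈ u n m) :
    ∃ f : ℕ → ℕ, ∀ x, ∀ᶠ n in cofinite, x ∈ u n (f n) := by
  classical
  by_cases hbad : ∃ n₀, ∀ m, u n₀ m ≠ univ
  · obtain ⟨n₀, hn₀⟩ := hbad
    set B : ℕ → Finset ℕ := fun n =>
      insert n₀ ((Finset.range (n + 1)).filter fun i => ∀ m, u i m ≠ univ)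
    set v : ℕ → ℕ → Set Y := fun n m => ⋂ i ∈ B n, u i m
    have hv : ∀ n, IsGammaCoverOf Y (range (v n)) := fun n => by
      refine isGammaCoverOf_range (fun m => ?_) (fun x => ?_) (fun m hm => hn₀ m ?_)
      · exact isOpen_biInter_finset fun i _ => hopen i m
      · simp only [v, mem_iInter]
        exact (eventually_all_finset _).2 fun i _ => hu i x
      · exact univ_subset_iff.1
          (hm ▸ biInter_subset_of_mem (show n₀ ∈ (B n : Set ℕ) by simp [B]))
    obtain ⟨U, hU, hUγ⟩ := h (fun n => range (v n)) hv
    choose f hf using hU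
    obtain ⟨φ, hφ, hinj⟩ := exists_strictMono_injective_comp hUγ.2.1
    have key : ∀ n, ∃ m, U (φ n) ⊆ u n m := fun n => by
      by_cases hn : ∃ m, u n m = univ
      · obtain ⟨m, hm⟩ := hn
        exact ⟨m, hm ▸ subset_univ _⟩
      · push Not at hn
        refine ⟨f (φ n), ?_⟩
        rw [← hf (φ n)]
        refine biInter_subset_of_mem (show n ∈ (B (φ n) : Set ℕ) from ?_)
        have := hφ.le_apply (x := n)
        simp only [B, Finset.coe_insert, mem_insert_iff, Finset.mem_coe, Finset.mem_filter,
          Finset.mem_range]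
        exact Or.inr ⟨by omega, hn⟩
    choose g hg using key
    refine ⟨g, fun x => ?_⟩
    refine ((hUγ.2.2 x).preimage hinj.injOn).subset fun n hn => ?_
    exact ⟨mem_range_self _, fun hx => hn (hg n hx)⟩
  · push Not at hbad
    choose f hf using hbad
    exact ⟨f, fun x => by simp [hf]⟩

open Filter in
/-- Under `S₁(Γ, Γ)`, one may select from each cover an infinite subsequence so that all the
selected sets together still contain each point with finitely many exceptions. -/
theorem S1.exists_double_selector {Y : Type*} [TopologicalSpace Y]
    (h : S1 Y (IsGammaCoverOf Y) (IsGammaCoverOf Y)) {u : ℕ → ℕ → Set Y}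
    (hopen : ∀ n m, IsOpen (u n m)) (hu : ∀ n x, ∀ᶠ m in cofinite, x ∈ u n m) :
    ∃ F : ℕ → ℕ → ℕ, (∀ n j, j ≤ F n j) ∧
      ∀ x, ∀ᶠ p : ℕ × ℕ in cofinite, x ∈ u p.1 (F p.1 p.2) := by
  obtain ⟨f, hf⟩ := h.exists_selector
    (u := fun p m => u p.unpair.1 (p.unpair.2 + m)) (fun _ _ => hopen _ _)
    (fun p x => (add_right_injective p.unpair.2).tendsto_cofinite.eventually (hu p.unpair.1 x))
  refine ⟨fun n j => j + f (Nat.pair n j), fun _ _ => Nat.le_add_right _ _, fun x => ?_⟩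
  have hinj : Function.Injective fun p : ℕ × ℕ => Nat.pair p.1 p.2 := Nat.pairEquiv.injective
  simpa using hinj.tendsto_cofinite.eventually (hf x)

open Filter in
theorem s1_gamma_gamma_linearly_sigma_additive {α : Type*} [TopologicalSpace α] (X : ℕ → Set α)
    (hmono : ∀ n, X n ⊆ X (n + 1))
    (h : ∀ n, S1 (X n) (IsGammaCoverOf (X n)) (IsGammaCoverOf (X n))) :
    S1 (⋃ n, X n) (IsGammaCoverOf (⋃ n, X n)) (IsGammaCoverOf (⋃ n, X n)) := by
  intro 𝒰 h𝒰
  let u : ℕ → ℕ → Set (⋃ n, X n) := fun n m => (h𝒰 n).2.1.natEmbedding _ m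
  have hu_mem : ∀ n m, u n m ∈ 𝒰 n := fun n m => ((h𝒰 n).2.1.natEmbedding _ m).2
  have hu_inj : ∀ n, Function.Injective (u n) := fun n =>
    Subtype.val_injective.comp ((h𝒰 n).2.1.natEmbedding _).injective
  have hu : ∀ n x, ∀ᶠ m in cofinite, x ∈ u n m := fun n x =>
    (((h𝒰 n).2.2 x).preimage (hu_inj n).injOn).subset fun m hm => ⟨hu_mem n m, hm⟩
  have tendsto_of_le : ∀ {G : ℕ → ℕ}, (∀ j, j ≤ G j) → Tendsto G cofinite cofinite := fun hG => by
    rw [Nat.cofinite_eq_atTop]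
    exact tendsto_atTop_mono hG tendsto_id
  let ι : ∀ k, X k → ⋃ n, X n := fun k => inclusion (subset_iUnion X k)
  have step : ∀ (k : ℕ) (G : {G : ℕ → ℕ → ℕ // ∀ n j, j ≤ G n j}),
      ∃ G' : {G : ℕ → ℕ → ℕ // ∀ n j, j ≤ G n j},
        (∀ n j, ∃ j', G'.1 n j = G.1 n j') ∧
        ∀ x, ∀ᶠ p : ℕ × ℕ in cofinite, ι k x ∈ u p.1 (G'.1 p.1 p.2) := fun k ⟨G, hG⟩ => by
    obtain ⟨F, hF, hFx⟩ := (h k).exists_double_selector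
      (u := fun n m => ι k ⁻¹' u n (G n m))
      (fun n m => ((h𝒰 n).1.1 _ (hu_mem n _)).preimage (continuous_inclusion _))
      (fun n x => (tendsto_of_le (hG n)).eventually (hu n (ι k x)))
    exact ⟨⟨fun n j => G n (F n j), fun n j => (hF n j).trans (hG n _)⟩,
      fun n j => ⟨F n j, rfl⟩, hFx⟩
  choose next hnext hnext_mem using step
  let G : ℕ → {G : ℕ → ℕ → ℕ // ∀ n j, j ≤ G n j} := fun k =>
    Nat.rec ⟨fun _ j => j, fun _ _ => le_rfl⟩ next k
  have hG_le : ∀ {k l}, k ≤ l → ∀ n j, ∃ j', (G l).1 n j = (G k).1 n j' := fun {k l} hkl => by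
    induction l, hkl using Nat.le_induction with
    | base => exact fun n j => ⟨j, rfl⟩
    | succ l _ ih =>
      intro n j
      obtain ⟨j₁, h₁⟩ := hnext l (G l) n j
      obtain ⟨j₂, h₂⟩ := ih n j₁
      exact ⟨j₂, h₁.trans h₂⟩
  obtain ⟨W, hW_inj, hW⟩ := exists_injective_forall_mem_of_infinite
    (S := fun n => u n '' range ((G (n + 1)).1 n)) fun n =>
      (infinite_of_not_bddAbove fun ⟨b, hb⟩ =>
        absurd ((G (n + 1)).2 n (b + 1)) (by
          have := hb (mem_range_self (b + 1))
          omega)).image (hu_inj n).injOn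
  have hWx : ∀ x, {n | x ∉ W n}.Finite := by
    rintro ⟨x, hx⟩
    obtain ⟨k, hk⟩ := mem_iUnion.1 hx
    refine (((hnext_mem k (G k) ⟨x, hk⟩ : Set.Finite _).image Prod.fst).union
      (finite_lt_nat k)).subset fun n hn => ?_
    rcases lt_or_ge n k with hlt | hge
    · exact Or.inr hlt
    · obtain ⟨_, ⟨j, rfl⟩, hj⟩ := hW n
      obtain ⟨j', hj'⟩ := hG_le (Nat.succ_le_succ hge) n j
      refine Or.inl ⟨(n, j'), fun hmem => hn ?_, rfl⟩
      rw [← hj, hj']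
      exact hmem
  have hW_mem : ∀ n, W n ∈ 𝒰 n := fun n => by
    obtain ⟨_, -, hj⟩ := hW n
    exact hj ▸ hu_mem n _
  refine ⟨W, hW_mem, ⟨?_, fun x => ?_⟩, infinite_range_of_injective hW_inj, fun x => ?_⟩
  · rintro _ ⟨n, rfl⟩
    exact (h𝒰 n).1.1 _ (hW_mem n)
  · obtain ⟨n, hn⟩ := (hWx x).infinite_compl.nonempty
    exact ⟨W n, mem_range_self n, not_not.1 hn⟩
  · refine ((hWx x).image W).subset ?_
    rintro _ ⟨⟨n, rfl⟩, hn⟩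
    exact ⟨n, hn, rfl⟩
end

section
/- The property S₁(Γ,O) is linearly-σ-additive: if X₁ ⊆ X₂ ⊆ X₃ ⊆ ⋯ is an increasing sequence of subsets of a topological space such that each Xₙ, with the subspace topology, satisfies S₁(Γ,O), then the union ⋃ₙ Xₙ, with the subspace topology, satisfies S₁(Γ,O). -/
open Set

variable (X : Type*) [TopologicalSpace X]

/-- If `Y` satisfies `S₁(Γ, O)` and `f : Y → Z` is continuous, then from any sequence of γ-covers
of `Z` one can select members, one from each, that together cover the range of `f`. -/
theorem S1.exists_selection_covering_range {Y Z : Type*} [TopologicalSpace Y] [TopologicalSpace Z]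
    (hY : S1 Y (IsGammaCoverOf Y) (IsOpenCoverOf Y)) {f : Y → Z} (hf : Continuous f)
    {𝒱 : ℕ → Set (Set Z)} (h𝒱 : ∀ n, IsGammaCoverOf Z (𝒱 n)) :
    ∃ V : ℕ → Set Z, (∀ n, V n ∈ 𝒱 n) ∧ ∀ y, ∃ n, f y ∈ V n := by
  by_cases hinf : ∀ n, ((fun V => f ⁻¹' V) '' 𝒱 n).Infinite
  · have hγ : ∀ n, IsGammaCoverOf Y ((fun V => f ⁻¹' V) '' 𝒱 n) := by
      refine fun n => ⟨⟨?_, fun y => ?_⟩, hinf n, fun y => ?_⟩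
      · rintro _ ⟨V, hV, rfl⟩
        exact ((h𝒱 n).1.1 V hV).preimage hf
      · obtain ⟨V, hV, hy⟩ := (h𝒱 n).1.2 (f y)
        exact ⟨_, ⟨V, hV, rfl⟩, hy⟩
      · refine (((h𝒱 n).2.2 (f y)).image (fun V => f ⁻¹' V)).subset ?_
        rintro _ ⟨⟨V, hV, rfl⟩, hy⟩
        exact ⟨V, ⟨hV, hy⟩, rfl⟩
    obtain ⟨U, hU, hcover⟩ := hY _ hγ
    choose V hV hVU using hU
    refine ⟨V, hV, fun y => ?_⟩
    obtain ⟨_, ⟨n, rfl⟩, hy⟩ := hcover.2 y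
    rw [← hVU n] at hy
    exact ⟨n, hy⟩
  · obtain ⟨n, hn⟩ := not_forall.1 hinf
    -- Infinitely many members of `𝒱 n` share one preimage, which must be everything.
    obtain ⟨V, hV, hfiber⟩ : ∃ V ∈ 𝒱 n, {W ∈ 𝒱 n | f ⁻¹' W = f ⁻¹' V}.Infinite := by
      by_contra! hfin
      refine (h𝒱 n).2.1 (((Set.not_infinite.1 hn).biUnion
        (t := fun T => {W ∈ 𝒱 n | f ⁻¹' W = T}) ?_).subset fun W hW => ?_)
      · rintro _ ⟨V, hV, rfl⟩
        exact hfin V hV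
      · exact Set.mem_biUnion ⟨W, hW, rfl⟩ ⟨hW, rfl⟩
    have hcover : ∀ y, f y ∈ V := by
      intro y
      by_contra hy
      refine hfiber (((h𝒱 n).2.2 (f y)).subset fun W hW => ⟨hW.1, fun hyW => hy ?_⟩)
      have : y ∈ f ⁻¹' W := hyW
      rwa [hW.2] at this
    choose V₀ hV₀ using fun m => (h𝒱 m).2.1.nonempty
    refine ⟨Function.update V₀ n V, fun m => ?_, fun y => ⟨n, by simpa using hcover y⟩⟩
    rcases eq_or_ne m n with rfl | hm
    · simpa using hV
    · simpa [hm] using hV₀ m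

theorem s1_gamma_o_linearly_sigma_additive {α : Type*} [TopologicalSpace α] (X : ℕ → Set α)
    (hmono : ∀ n, X n ⊆ X (n + 1))
    (h : ∀ n, S1 (X n) (IsGammaCoverOf (X n)) (IsOpenCoverOf (X n))) :
    S1 (⋃ n, X n) (IsGammaCoverOf (⋃ n, X n)) (IsOpenCoverOf (⋃ n, X n)) := by
  intro 𝒰 h𝒰
  choose V hV hcover using fun k => (h k).exists_selection_covering_range
    (continuous_inclusion (Set.subset_iUnion X k)) (fun m => h𝒰 (Nat.pair k m))
  have hmem : ∀ n, V n.unpair.1 n.unpair.2 ∈ 𝒰 n := fun n => by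
    simpa using hV n.unpair.1 n.unpair.2
  refine ⟨fun n => V n.unpair.1 n.unpair.2, hmem, ?_, ?_⟩
  · rintro _ ⟨n, rfl⟩
    exact (h𝒰 n).1.1 _ (hmem n)
  · rintro ⟨x, hx⟩
    obtain ⟨k, hk⟩ := Set.mem_iUnion.1 hx
    obtain ⟨m, hm⟩ := hcover k ⟨x, hk⟩
    exact ⟨_, ⟨Nat.pair k m, rfl⟩, by simpa using hm⟩
end

section
/- The property Sfin(Ω,Ω) is linearly-σ-additive: if X₁ ⊆ X₂ ⊆ X₃ ⊆ ⋯ is an increasing sequence of subsets of a topological space such that each Xₙ, with the subspace topology, satisfies Sfin(Ω,Ω), then the union ⋃ₙ Xₙ, with the subspace topology, satisfies Sfin(Ω,Ω). -/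
open Set

variable (X : Type*) [TopologicalSpace X]

/-- Transfer of `Sfin(Ω, Ω)` along a continuous map: from a sequence of families of open sets of
`Y`, each capturing all finite subsets of `Y`, one can select finite subfamilies which together
capture the image of every finite subset of `A`. Members containing the whole image of `A` are
allowed. -/
theorem Sfin.exists_finite_subfamilies_of_continuous {A Y : Type*} [TopologicalSpace A]
    [TopologicalSpace Y] (hA : Sfin A (IsOmegaCoverOf A) (IsOmegaCoverOf A)) {f : A → Y}
    (hf : Continuous f) (𝒰 : ℕ → Set (Set Y)) (hopen : ∀ n, ∀ U ∈ 𝒰 n, IsOpen U)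
    (hfin : ∀ n, ∀ S : Set Y, S.Finite → ∃ U ∈ 𝒰 n, S ⊆ U) :
    ∃ F : ℕ → Set (Set Y), (∀ n, F n ⊆ 𝒰 n ∧ (F n).Finite) ∧
      ∀ S : Set A, S.Finite → ∃ n, ∃ U ∈ F n, f '' S ⊆ U := by
  by_cases hall : ∃ n, ∃ U ∈ 𝒰 n, f ⁻¹' U = Set.univ
  · obtain ⟨n, U, hU, huniv⟩ := hall
    refine ⟨fun m => {U} ∩ 𝒰 m,
      fun m => ⟨inter_subset_right, (finite_singleton U).inter_of_left _⟩,
      fun S _ => ⟨n, U, ⟨rfl, hU⟩, ?_⟩⟩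
    rw [image_subset_iff, huniv]
    exact subset_univ S
  · have hcapture : ∀ n, ∀ S : Set A, S.Finite → ∃ V ∈ preimage f '' 𝒰 n, S ⊆ V := by
      intro n S hS
      obtain ⟨U, hU, hSU⟩ := hfin n (f '' S) (hS.image f)
      exact ⟨f ⁻¹' U, mem_image_of_mem _ hU, image_subset_iff.1 hSU⟩
    have hcover : ∀ n, IsOmegaCoverOf A (preimage f '' 𝒰 n) := by
      refine fun n => ⟨⟨?_, fun x => ?_⟩, ?_, hcapture n⟩
      · rintro _ ⟨U, hU, rfl⟩
        exact (hopen n U hU).preimage hf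
      · obtain ⟨V, hV, hxV⟩ := hcapture n {x} (finite_singleton x)
        exact ⟨V, hV, hxV rfl⟩
      · rintro ⟨U, hU, huniv⟩
        exact hall ⟨n, U, hU, huniv⟩
    obtain ⟨G, hG, -, -, hGfin⟩ := hA _ hcover
    have hlift : ∀ n, ∃ F ⊆ 𝒰 n, F.Finite ∧ preimage f '' F = G n := fun n =>
      exists_subset_image_finite_and (p := (· = G n)).1 ⟨G n, (hG n).1, (hG n).2, rfl⟩
    choose F hF𝒰 hFfin hFG using hlift
    refine ⟨F, fun n => ⟨hF𝒰 n, hFfin n⟩, fun S hS => ?_⟩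
    obtain ⟨V, hV, hSV⟩ := hGfin S hS
    obtain ⟨n, hVn⟩ := mem_iUnion.1 hV
    rw [← hFG n] at hVn
    obtain ⟨U, hU, rfl⟩ := hVn
    exact ⟨n, U, hU, image_subset_iff.2 hSV⟩

theorem sfin_omega_omega_linearly_sigma_additive {α : Type*} [TopologicalSpace α] (X : ℕ → Set α)
    (hmono : ∀ n, X n ⊆ X (n + 1))
    (h : ∀ n, Sfin (X n) (IsOmegaCoverOf (X n)) (IsOmegaCoverOf (X n))) :
    Sfin (⋃ n, X n) (IsOmegaCoverOf (⋃ n, X n)) (IsOmegaCoverOf (⋃ n, X n)) := by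
  intro 𝒰 h𝒰
  have hsub : ∀ k, X k ⊆ ⋃ n, X n := subset_iUnion X
  -- `X k` is handled with the covers `𝒰 k, 𝒰 (k + 1), …` only.
  choose F hF hFcapture using fun k =>
    (h k).exists_finite_subfamilies_of_continuous (continuous_inclusion (hsub k))
      (fun n => 𝒰 (k + n)) (fun n => (h𝒰 (k + n)).1.1) (fun n => (h𝒰 (k + n)).2.2)
  have hmem : ∀ n, ⋃ k ∈ Iic n, F k (n - k) ⊆ 𝒰 n := by
    refine fun n => iUnion₂_subset fun k hk => ?_
    have hk' := (hF k (n - k)).1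
    rwa [Nat.add_sub_cancel' hk] at hk'
  have hcapture : ∀ S : Set (⋃ n, X n), S.Finite →
      ∃ U ∈ ⋃ n, ⋃ k ∈ Iic n, F k (n - k), S ⊆ U := by
    intro S hS
    obtain ⟨k, hk⟩ : ∃ k, Subtype.val '' S ⊆ X k := by
      rw [← (hS.image _).coe_toFinset]
      refine (monotone_nat_of_le_succ hmono).directed_le.exists_mem_subset_of_finset_subset_biUnion
        ?_
      rw [Finite.coe_toFinset]
      rintro _ ⟨x, -, rfl⟩
      exact x.2
    obtain ⟨n, U, hU, hSU⟩ := hFcapture k (inclusion (hsub k) ⁻¹' S)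
      (hS.preimage (inclusion_injective (hsub k)).injOn)
    refine ⟨U, mem_iUnion.2 ⟨k + n, mem_iUnion₂.2 ⟨k, Nat.le_add_right k n, ?_⟩⟩, ?_⟩
    · rwa [Nat.add_sub_cancel_left]
    · intro x hx
      exact hSU ⟨⟨x, hk (mem_image_of_mem _ hx)⟩, hx, rfl⟩
  refine ⟨fun n => ⋃ k ∈ Iic n, F k (n - k),
    fun n => ⟨hmem n, (finite_Iic n).biUnion fun k _ => (hF k (n - k)).2⟩,
    ⟨fun U hU => ?_, fun x => ?_⟩, fun huniv => ?_, hcapture⟩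
  · obtain ⟨n, hn⟩ := mem_iUnion.1 hU
    exact (h𝒰 n).1.1 U (hmem n hn)
  · obtain ⟨U, hU, hxU⟩ := hcapture {x} (finite_singleton x)
    exact ⟨U, hU, hxU rfl⟩
  · obtain ⟨n, hn⟩ := mem_iUnion.1 huniv
    exact (h𝒰 n).2.1 (hmem n hn)
end

section
/- The property Ufin(Γ,Ω) is linearly-σ-additive: if X₁ ⊆ X₂ ⊆ X₃ ⊆ ⋯ is an increasing sequence of subsets of a topological space such that each Xₙ, with the subspace topology, satisfies Ufin(Γ,Ω), then the union ⋃ₙ Xₙ, with the subspace topology, satisfies Ufin(Γ,Ω). -/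
open Set

variable (X : Type*) [TopologicalSpace X]

/-- If `Z` satisfies `Ufin(Γ, Ω)` and `j : Z → Y` is continuous, then for every sequence of open
covers of `Y` one can pick finite subfamilies such that the image of each finite subset of `Z` is
covered by infinitely many of them. -/
theorem Ufin.exists_finite_frequently_image_subset {Y Z : Type*} [TopologicalSpace Y]
    [TopologicalSpace Z] (hZ : Ufin Z (IsOmegaCoverOf Z)) {j : Z → Y} (hj : Continuous j)
    (𝒰 : ℕ → Set (Set Y)) (h𝒰 : ∀ n, IsOpenCoverOf Y (𝒰 n)) :
    ∃ F : ℕ → Set (Set Y), (∀ n, F n ⊆ 𝒰 n ∧ (F n).Finite) ∧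
      ∀ A : Set Z, A.Finite → ∀ M, ∃ n ≥ M, j '' A ⊆ ⋃₀ F n := by
  classical
  by_cases hfreq : ∀ M, ∃ n ≥ M, ∃ F ⊆ 𝒰 n, F.Finite ∧ range j ⊆ ⋃₀ F
  · refine ⟨fun n => if h : ∃ F ⊆ 𝒰 n, F.Finite ∧ range j ⊆ ⋃₀ F then h.choose else ∅, ?_, ?_⟩
    · intro n
      dsimp only
      split_ifs with h
      · exact ⟨h.choose_spec.1, h.choose_spec.2.1⟩
      · exact ⟨empty_subset _, finite_empty⟩
    · intro A _ M
      obtain ⟨n, hn, h⟩ := hfreq M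
      refine ⟨n, hn, ?_⟩
      dsimp only
      rw [dif_pos h]
      exact (image_subset_range j A).trans h.choose_spec.2.2
  · push Not at hfreq
    obtain ⟨N, hN⟩ := hfreq
    obtain ⟨G, hG, -, -, hω⟩ := hZ (fun k => preimage j '' 𝒰 (N + k)) (by
      refine fun k => ⟨⟨?_, fun z => ?_⟩, ?_⟩
      · rintro _ ⟨U, hU, rfl⟩
        exact ((h𝒰 _).1 U hU).preimage hj
      · obtain ⟨U, hU, hz⟩ := (h𝒰 (N + k)).2 (j z)
        exact ⟨_, mem_image_of_mem _ hU, hz⟩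
      · rintro ⟨G, hG, hGfin, hcov⟩
        obtain ⟨F, hF, hFfin, rfl⟩ := exists_subset_image_finite_and (p := (· = G)) |>.1 ⟨G, hG, hGfin, rfl⟩
        refine hN (N + k) (Nat.le_add_right _ _) F hF hFfin ?_
        rintro _ ⟨z, rfl⟩
        obtain ⟨_, ⟨U, hU, rfl⟩, hz⟩ := hcov z
        exact ⟨U, hU, hz⟩)
    have hlift : ∀ k, ∃ F ⊆ 𝒰 (N + k), F.Finite ∧ preimage j '' F = G k := fun k =>
      exists_subset_image_finite_and (p := (· = G k)) |>.1 ⟨G k, (hG k).1, (hG k).2, rfl⟩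
    choose F hF hFfin hFG using hlift
    have hmiss : ∀ k, ∃ z, j z ∉ ⋃₀ F k := by
      intro k
      simpa [range_subset_iff] using hN (N + k) (Nat.le_add_right _ _) (F k) (hF k) (hFfin k)
    choose z hz using hmiss
    have hsub : ∀ k, ∀ x ∈ ⋃₀ G k, j x ∈ ⋃₀ F k := by
      rintro k x ⟨V, hV, hx⟩
      rw [← hFG] at hV
      obtain ⟨U, hU, rfl⟩ := hV
      exact ⟨U, hU, hx⟩
    refine ⟨fun n => if N ≤ n then F (n - N) else ∅, fun n => ?_, fun A hA M => ?_⟩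
    · dsimp only
      split_ifs with h
      · refine ⟨?_, hFfin _⟩
        simpa [Nat.add_sub_cancel' h] using hF (n - N)
      · exact ⟨empty_subset _, finite_empty⟩
    · obtain ⟨_, ⟨k, rfl⟩, hk⟩ := hω (A ∪ z '' Iio M) (hA.union ((finite_Iio M).image z))
      have hMk : M ≤ k := by
        by_contra! h
        exact hz k (hsub k _ (hk (Or.inr ⟨k, h, rfl⟩)))
      refine ⟨N + k, by lia, ?_⟩
      rintro _ ⟨x, hx, rfl⟩
      simpa using hsub k x (hk (Or.inl hx))

theorem ufin_gamma_omega_linearly_sigma_additive {α : Type*} [TopologicalSpace α] (X : ℕ → Set α)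
    (hmono : ∀ n, X n ⊆ X (n + 1))
    (h : ∀ n, Ufin (X n) (IsOmegaCoverOf (X n))) :
    Ufin (⋃ n, X n) (IsOmegaCoverOf (⋃ n, X n)) := by
  intro 𝒰 h𝒰
  choose F hF hFω using fun m => (h m).exists_finite_frequently_image_subset
    (continuous_inclusion (subset_iUnion X m)) 𝒰 fun n => (h𝒰 n).1
  have hsub : ∀ n, (⋃ m ∈ Iic n, F m n) ⊆ 𝒰 n := fun n => iUnion₂_subset fun m _ => (hF m n).1
  have hfin : ∀ n, (⋃ m ∈ Iic n, F m n).Finite := fun n =>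
    (finite_Iic n).biUnion fun m _ => (hF m n).2
  have hω : ∀ A : Set (⋃ n, X n), A.Finite → ∃ n, A ⊆ ⋃₀ ⋃ m ∈ Iic n, F m n := by
    intro A hA
    have hdir : Directed (· ⊆ ·) X := (monotone_nat_of_le_succ hmono).directed_le
    obtain ⟨m, hm⟩ := hdir.exists_mem_subset_of_finset_subset_biUnion
      (s := (hA.image Subtype.val).toFinset) (by
        rw [Finite.coe_toFinset]
        rintro _ ⟨x, -, rfl⟩
        exact x.2)
    rw [Finite.coe_toFinset] at hm
    obtain ⟨n, hn, hAn⟩ := hFω m (inclusion (subset_iUnion X m) ⁻¹' A)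
      (hA.preimage (inclusion_injective _).injOn) m
    refine ⟨n, fun x hx => ?_⟩
    obtain ⟨U, hU, hxU⟩ := hAn ⟨⟨x, hm ⟨x, hx, rfl⟩⟩, hx, rfl⟩
    exact ⟨U, mem_biUnion (mem_Iic.2 hn) hU, hxU⟩
  refine ⟨fun n => ⋃ m ∈ Iic n, F m n, fun n => ⟨hsub n, hfin n⟩, ⟨?_, fun x => ?_⟩, ?_, ?_⟩
  · rintro _ ⟨n, rfl⟩
    exact isOpen_sUnion fun U hU => (h𝒰 n).1.1 U (hsub n hU)
  · obtain ⟨n, hn⟩ := hω {x} (finite_singleton x)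
    exact ⟨_, ⟨n, rfl⟩, hn rfl⟩
  · rintro ⟨n, hn⟩
    exact (h𝒰 n).2 ⟨_, hsub n, hfin n, fun x => mem_sUnion.1 (hn.ge (mem_univ x))⟩
  · intro A hA
    obtain ⟨n, hn⟩ := hω A hA
    exact ⟨_, ⟨n, rfl⟩, hn⟩
end

section
/- The property Ufin(Γ,O) is linearly-σ-additive: if X₁ ⊆ X₂ ⊆ X₃ ⊆ ⋯ is an increasing sequence of subsets of a topological space such that each Xₙ, with the subspace topology, satisfies Ufin(Γ,O), then the union ⋃ₙ Xₙ, with the subspace topology, satisfies Ufin(Γ,O). -/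
open Set

variable (X : Type*) [TopologicalSpace X]

/-- Under `Ufin(Γ, O)`, finite subfamilies with covering union can be selected from any sequence of
open covers, including covers that have finite subcovers. -/
theorem Ufin.exists_finite_subfamilies {Y : Type*} [TopologicalSpace Y]
    (h : Ufin Y (IsOpenCoverOf Y)) (𝒰 : ℕ → Set (Set Y)) (h𝒰 : ∀ n, IsOpenCoverOf Y (𝒰 n)) :
    ∃ F : ℕ → Set (Set Y), (∀ n, F n ⊆ 𝒰 n ∧ (F n).Finite) ∧ ∀ y, ∃ n, y ∈ ⋃₀ F n := by
  by_cases hfin : ∃ n, ∃ F ⊆ 𝒰 n, F.Finite ∧ ∀ x : Y, ∃ U ∈ F, x ∈ U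
  · obtain ⟨n, F, hF, hFfin, hcov⟩ := hfin
    refine ⟨fun m => {U ∈ F | m = n}, fun m => ⟨?_, hFfin.subset (sep_subset _ _)⟩, fun y => ?_⟩
    · rintro U ⟨hU, rfl⟩
      exact hF hU
    · obtain ⟨U, hU, hy⟩ := hcov y
      exact ⟨n, U, ⟨hU, rfl⟩, hy⟩
  · obtain ⟨F, hF, -, hcov⟩ := h 𝒰 fun n => ⟨h𝒰 n, fun hn => hfin ⟨n, hn⟩⟩
    refine ⟨F, hF, fun y => ?_⟩
    obtain ⟨_, ⟨n, rfl⟩, hy⟩ := hcov y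
    exact ⟨n, hy⟩

/-- A continuous image of a space satisfying `Ufin(Γ, O)` is covered by finite subfamilies selected
from any sequence of open covers of the codomain. -/
theorem Ufin.exists_finite_subfamilies_of_continuous {Y Z : Type*} [TopologicalSpace Y]
    [TopologicalSpace Z] (h : Ufin Y (IsOpenCoverOf Y)) {f : Y → Z} (hf : Continuous f)
    (𝒰 : ℕ → Set (Set Z)) (h𝒰 : ∀ n, IsOpenCoverOf Z (𝒰 n)) :
    ∃ F : ℕ → Set (Set Z), (∀ n, F n ⊆ 𝒰 n ∧ (F n).Finite) ∧ ∀ y, ∃ n, f y ∈ ⋃₀ F n := by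
  obtain ⟨G, hG, hcov⟩ := h.exists_finite_subfamilies (fun n => preimage f '' 𝒰 n) fun n => by
    refine ⟨?_, fun y => ?_⟩
    · rintro _ ⟨U, hU, rfl⟩
      exact ((h𝒰 n).1 U hU).preimage hf
    · obtain ⟨U, hU, hy⟩ := (h𝒰 n).2 (f y)
      exact ⟨_, mem_image_of_mem _ hU, hy⟩
  choose F hF hFfin hFG using fun n =>
    exists_subset_image_finite_and (p := (· = G n)).mp ⟨G n, (hG n).1, (hG n).2, rfl⟩
  refine ⟨F, fun n => ⟨hF n, hFfin n⟩, fun y => ?_⟩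
  obtain ⟨n, V, hV, hy⟩ := hcov y
  rw [← hFG n] at hV
  obtain ⟨U, hU, rfl⟩ := hV
  exact ⟨n, U, hU, hy⟩

theorem ufin_gamma_o_linearly_sigma_additive {α : Type*} [TopologicalSpace α] (X : ℕ → Set α)
    (hmono : ∀ n, X n ⊆ X (n + 1))
    (h : ∀ n, Ufin (X n) (IsOpenCoverOf (X n))) :
    Ufin (⋃ n, X n) (IsOpenCoverOf (⋃ n, X n)) := by
  intro 𝒰 h𝒰
  choose F hF hcov using fun n =>
    (h n).exists_finite_subfamilies_of_continuous
      (continuous_inclusion (subset_iUnion X n)) (fun k => 𝒰 (Nat.pair n k))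
      fun k => (h𝒰 (Nat.pair n k)).1
  have hF' : ∀ m, F m.unpair.1 m.unpair.2 ⊆ 𝒰 m ∧ (F m.unpair.1 m.unpair.2).Finite := fun m => by
    simpa using hF m.unpair.1 m.unpair.2
  refine ⟨fun m => F m.unpair.1 m.unpair.2, hF', ?_, ?_⟩
  · rintro _ ⟨m, rfl⟩
    exact isOpen_sUnion fun U hU => (h𝒰 m).1.1 U ((hF' m).1 hU)
  · rintro ⟨x, hx⟩
    obtain ⟨n, hxn⟩ := mem_iUnion.mp hx
    obtain ⟨k, hk⟩ := hcov n ⟨x, hxn⟩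
    exact ⟨_, ⟨Nat.pair n k, rfl⟩, by simpa using hk⟩
end

section
/- There exists a constant C > 0 such that for every natural number k ≥ 2 there exist a natural number n with n ≤ C · Real.log k and a topology on the finite set Fin n having exactly k open sets. -/
/-- Adding an isolated point doubles the number of open sets. -/
theorem exists_topology_ncard_two_mul {n : ℕ} (τ : TopologicalSpace (Fin n)) :
    ∃ σ : TopologicalSpace (Fin (n + 1)),
      {s : Set (Fin (n + 1)) | σ.IsOpen s}.ncard =
        2 * {s : Set (Fin n) | τ.IsOpen s}.ncard := by
  refine ⟨τ.coinduced Fin.castSucc, ?_⟩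
  have hinj : Function.Injective fun s : Set (Fin n) => Fin.castSucc '' s :=
    (Fin.castSucc_injective n).image_injective
  have hpre (s : Set (Fin n)) :
      Fin.castSucc ⁻¹' insert (Fin.last n) (Fin.castSucc '' s) = s := by
    ext x
    simp [(Fin.castSucc_lt_last x).ne]
  have hinj' : Function.Injective fun s : Set (Fin n) =>
      insert (Fin.last n) (Fin.castSucc '' s) := fun s t h => by
    simpa only [hpre] using congrArg (Fin.castSucc ⁻¹' ·) h
  have hopens : {s : Set (Fin (n + 1)) | (τ.coinduced Fin.castSucc).IsOpen s} =
      (fun s : Set (Fin n) => Fin.castSucc '' s) '' {s | τ.IsOpen s} ∪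
        (fun s : Set (Fin n) => insert (Fin.last n) (Fin.castSucc '' s)) ''
          {s | τ.IsOpen s} := by
    ext s
    constructor
    · intro hs
      by_cases hl : Fin.last n ∈ s
      · refine Or.inr ⟨Fin.castSucc ⁻¹' s, hs, ?_⟩
        ext x
        cases x using Fin.lastCases <;> simp [hl, (Fin.castSucc_lt_last _).ne]
      · refine Or.inl ⟨Fin.castSucc ⁻¹' s, hs, ?_⟩
        ext x
        cases x using Fin.lastCases <;> simp [hl, (Fin.castSucc_lt_last _).ne]
    · rintro (⟨t, ht, rfl⟩ | ⟨t, ht, rfl⟩)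
      · change τ.IsOpen (Fin.castSucc ⁻¹' (Fin.castSucc '' t))
        rwa [Set.preimage_image_eq _ (Fin.castSucc_injective n)]
      · change τ.IsOpen (Fin.castSucc ⁻¹' insert (Fin.last n) (Fin.castSucc '' t))
        rwa [hpre]
  rw [hopens, Set.ncard_union_eq, Set.ncard_image_of_injective _ hinj,
    Set.ncard_image_of_injective _ hinj', two_mul]
  rw [Set.disjoint_left]
  rintro _ ⟨t, -, rfl⟩ ⟨u, -, hu⟩
  have hl : Fin.last n ∈ Fin.castSucc '' t :=
    (Set.ext_iff.1 hu _).1 (Set.mem_insert _ _)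
  obtain ⟨x, -, hx⟩ := hl
  exact (Fin.castSucc_lt_last x).ne hx

/-- Adding a point whose only neighbourhood is the whole space adds one open set. -/
theorem exists_topology_ncard_add_one {n : ℕ} (τ : TopologicalSpace (Fin n)) :
    ∃ σ : TopologicalSpace (Fin (n + 1)),
      {s : Set (Fin (n + 1)) | σ.IsOpen s}.ncard =
        {s : Set (Fin n) | τ.IsOpen s}.ncard + 1 := by
  refine ⟨{ IsOpen := fun s =>
              τ.IsOpen (Fin.castSucc ⁻¹' s) ∧ (Fin.last n ∈ s → s = Set.univ)
            isOpen_univ := ⟨τ.isOpen_univ, fun _ => rfl⟩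
            isOpen_inter := ?_
            isOpen_sUnion := ?_ }, ?_⟩
  · rintro s t ⟨hs, hs'⟩ ⟨ht, ht'⟩
    refine ⟨τ.isOpen_inter _ _ hs ht, fun h => ?_⟩
    rw [hs' h.1, ht' h.2, Set.univ_inter]
  · refine fun S hS => ⟨?_, ?_⟩
    · rw [Set.preimage_sUnion]
      exact isOpen_biUnion fun t ht => (hS t ht).1
    · rintro ⟨t, ht, hlt⟩
      exact Set.univ_subset_iff.1 ((hS t ht).2 hlt ▸ Set.subset_sUnion_of_mem ht)
  · have hinj : Function.Injective fun s : Set (Fin n) => Fin.castSucc '' s :=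
      (Fin.castSucc_injective n).image_injective
    have hlast (t : Set (Fin n)) : Fin.last n ∉ Fin.castSucc '' t := by
      rintro ⟨x, -, hx⟩
      exact (Fin.castSucc_lt_last x).ne hx
    have hopens : {s : Set (Fin (n + 1)) |
        τ.IsOpen (Fin.castSucc ⁻¹' s) ∧ (Fin.last n ∈ s → s = Set.univ)} =
        insert Set.univ
          ((fun s : Set (Fin n) => Fin.castSucc '' s) '' {s | τ.IsOpen s}) := by
      ext s
      constructor
      · rintro ⟨hs, hs'⟩
        by_cases hl : Fin.last n ∈ s
        · exact Or.inl (hs' hl)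
        · refine Or.inr ⟨Fin.castSucc ⁻¹' s, hs, ?_⟩
          ext x
          cases x using Fin.lastCases <;> simp [hl, (Fin.castSucc_lt_last _).ne]
      · rintro (rfl | ⟨t, ht, rfl⟩)
        · exact ⟨τ.isOpen_univ, fun _ => rfl⟩
        · refine ⟨?_, fun h => absurd h (hlast t)⟩
          rwa [Set.preimage_image_eq _ (Fin.castSucc_injective n)]
    change Set.ncard {s : Set (Fin (n + 1)) |
        τ.IsOpen (Fin.castSucc ⁻¹' s) ∧ (Fin.last n ∈ s → s = Set.univ)} = _
    rw [hopens, Set.ncard_insert_of_notMem, Set.ncard_image_of_injective _ hinj]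
    rintro ⟨t, -, ht⟩
    exact hlast t ((Set.ext_iff.1 ht _).2 (Set.mem_univ _))

/-- Every `k ≥ 1` is the number of open sets of a topology on at most `2 * Nat.log 2 k` points. -/
theorem exists_topology_ncard_eq (k : ℕ) (hk : 1 ≤ k) :
    ∃ n : ℕ, n ≤ 2 * Nat.log 2 k ∧
      ∃ τ : TopologicalSpace (Fin n), {s : Set (Fin n) | τ.IsOpen s}.ncard = k := by
  induction k using Nat.strong_induction_on with
  | _ k ih =>
    obtain rfl | hk2 := hk.eq_or_lt
    · refine ⟨0, Nat.zero_le _, ⊥, ?_⟩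
      rw [Set.ncard_eq_one]
      refine ⟨∅, Set.eq_singleton_iff_unique_mem.2 ⟨?_, fun s _ => Subsingleton.elim _ _⟩⟩
      exact @isOpen_empty _ ⊥
    · obtain ⟨n, hn, τ, hτ⟩ := ih (k / 2) (by lia) (by lia)
      have hlog : Nat.log 2 k = Nat.log 2 (k / 2) + 1 :=
        Nat.log_of_one_lt_of_le one_lt_two hk2
      obtain ⟨σ, hσ⟩ := exists_topology_ncard_two_mul τ
      obtain hmod | hmod := Nat.mod_two_eq_zero_or_one k
      · exact ⟨n + 1, by lia, σ, by lia⟩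
      · obtain ⟨ρ, hρ⟩ := exists_topology_ncard_add_one σ
        exact ⟨n + 1 + 1, by lia, ρ, by lia⟩

/-- There is a constant `C > 0` such that every `k ≥ 2` is the number of open sets
of a topology on a finite set with at most `C * log k` points. -/
theorem exists_log_bound_topology_sizes :
    ∃ C : ℝ, 0 < C ∧ ∀ k : ℕ, 2 ≤ k →
      ∃ n : ℕ, (n : ℝ) ≤ C * Real.log k ∧
        ∃ τ : TopologicalSpace (Fin n), {s : Set (Fin n) | τ.IsOpen s}.ncard = k := by
  refine ⟨2 / Real.log 2, by positivity, fun k hk => ?_⟩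
  obtain ⟨n, hn, hτ⟩ := exists_topology_ncard_eq k (by lia)
  refine ⟨n, ?_, hτ⟩
  calc (n : ℝ) ≤ 2 * (Nat.log 2 k : ℝ) := by exact_mod_cast hn
    _ ≤ 2 * Real.logb 2 k := by
        gcongr
        exact_mod_cast Real.natLog_le_logb k 2
    _ = 2 / Real.log 2 * Real.log k := by
        rw [Real.logb]
        ring
end
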